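/- Let X be a real Gaussian random variable with mean μ and standard deviation σ > 0, and let f* ∈ ℝ. Then the expected improvement E[ max(f* − X, 0) ] equals (f* − μ)Φ(z) + σφ(z), where z = (f* − μ)/σ, Φ is the cumulative distribution function of the standard normal distribution, and φ is its probability density function. -/

import Mathlib

open MeasureTheory ProbabilityTheory

noncomputable section

lemma hasDerivAt_pdf (x : ℝ) :
    HasDerivAt (fun x => -gaussianPDFReal 0 1 x) (gaussianPDFReal 0 1 x * x) x := by
  have h : HasDerivAt (fun x : ℝ => -(x ^ 2) / 2) (-x) x := by
    exact (((hasDerivAt_pow 2 x).neg).div_const 2).congr_deriv (by norm_num; ring)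
  have h2 := (h.exp.const_mul (√(2 * Real.pi))⁻¹).neg
  have h3 : (fun x => -gaussianPDFReal 0 1 x) =
      -fun y => (√(2 * Real.pi))⁻¹ * Real.exp (-y ^ 2 / 2) := by
    funext y
    simp [gaussianPDFReal]
  rw [h3]
  refine h2.congr_deriv ?_
  simp [gaussianPDFReal]
  ring

lemma integrable_pdf_mul : Integrable (fun x : ℝ => gaussianPDFReal 0 1 x * x) := by
  have h := (integrable_mul_exp_neg_mul_sq (b := 1 / 2) (by norm_num)).const_mul
    (√(2 * Real.pi))⁻¹
  convert h using 1
  funext x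
  simp only [gaussianPDFReal, NNReal.coe_one, mul_one, sub_zero]
  rw [show -x ^ 2 / 2 = -(1 / 2) * x ^ 2 by ring]
  ring

lemma tendsto_pdf :
    Filter.Tendsto (fun x => -gaussianPDFReal 0 1 x) Filter.atBot (nhds 0) := by
  have h : Filter.Tendsto (fun x : ℝ => -(x ^ 2) / 2) Filter.atBot Filter.atBot := by
    have h1 : Filter.Tendsto (fun x : ℝ => x ^ 2) Filter.atBot Filter.atTop := by
      have := (Filter.tendsto_pow_atTop (α := ℝ) (n := 2) (by norm_num)).comp
        Filter.tendsto_neg_atBot_atTop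
      simpa [Function.comp_def] using this
    exact (Filter.tendsto_neg_atTop_atBot.comp h1).atBot_div_const (by norm_num)
  have h2 := ((Real.tendsto_exp_atBot.comp h).const_mul (√(2 * Real.pi))⁻¹).neg
  convert h2 using 1
  · funext y
    simp [gaussianPDFReal]
  · simp

lemma setIntegral_gauss (z : ℝ) :
    ∫ x in Set.Iic z, x ∂(gaussianReal 0 1) = -gaussianPDFReal 0 1 z := by
  rw [← integral_indicator measurableSet_Iic,
    integral_gaussianReal_eq_integral_smul (by norm_num)]
  have : ∀ x : ℝ, gaussianPDFReal 0 1 x • (Set.Iic z).indicator (fun x => x) x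
      = (Set.Iic z).indicator (fun x => gaussianPDFReal 0 1 x * x) x := by
    intro x
    by_cases h : x ∈ Set.Iic z <;> simp [h]
  simp_rw [this]
  rw [integral_indicator measurableSet_Iic,
    integral_Iic_of_hasDerivAt_of_tendsto' (fun x _ => hasDerivAt_pdf x)
      integrable_pdf_mul.integrableOn tendsto_pdf]
  simp

lemma std_case (z : ℝ) : ∫ x, max (z - x) 0 ∂(gaussianReal 0 1) =
    z * cdf (gaussianReal 0 1) z + gaussianPDFReal 0 1 z := by
  have h : ∀ x : ℝ, max (z - x) 0 = (Set.Iic z).indicator (fun x => z - x) x := by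
    intro x
    by_cases h : x ≤ z
    · simp [h]
    · simp [h, (not_le.mp h).le]
  simp_rw [h]
  have hi : Integrable (fun x : ℝ => x) (gaussianReal 0 1) :=
    (memLp_id_gaussianReal (μ := 0) (v := 1) 1).integrable (by simp)
  rw [integral_indicator measurableSet_Iic,
    integral_sub (integrable_const _) hi.integrableOn, setIntegral_gauss, cdf_eq_real]
  simp
  ring

/-- Closed form of the expected-improvement acquisition function: if
`X ∼ 𝒩(μ, σ²)` with `σ > 0` and `f* ∈ ℝ`, then
`E[max(f* − X, 0)] = (f* − μ)Φ(z) + σφ(z)` with `z = (f* − μ)/σ`, where `Φ` and `φ` are the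
standard normal CDF and PDF. -/
theorem statement13 (μ σ fstar : ℝ) (hσ : 0 < σ) :
    ∫ x, max (fstar - x) 0 ∂(gaussianReal μ (Real.toNNReal (σ ^ 2))) =
      (fstar - μ) * cdf (gaussianReal 0 1) ((fstar - μ) / σ) +
        σ * gaussianPDFReal 0 1 ((fstar - μ) / σ) := by
  have hm : gaussianReal μ (Real.toNNReal (σ ^ 2)) =
      (gaussianReal 0 1).map (fun x => μ + σ * x) := by
    have h1 : (fun x : ℝ => μ + σ * x) = (fun x => μ + x) ∘ (fun x => σ * x) := rfl
    rw [h1, ← Measure.map_map (by fun_prop) (by fun_prop), gaussianReal_map_const_mul,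
      gaussianReal_map_const_add]
    congr 1
    · simp
    · ext
      simp [sq_nonneg]
  rw [hm, integral_map (by fun_prop) (by fun_prop)]
  have h : ∀ x : ℝ, max (fstar - (μ + σ * x)) 0 = σ * max ((fstar - μ) / σ - x) 0 := by
    intro x
    rw [mul_max_of_nonneg _ _ hσ.le]
    congr 1
    · field_simp
      ring
    · simp
  simp_rw [h]
  rw [integral_const_mul, std_case]
  field_simp
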